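/- arXiv:1206.3510 — 2 statements merged into one kernel-verified Lean document; each statement's English description precedes it below -/
import Mathlib

section
/- For every positive integer n, Σ_{σ ∈ S_n} p^{res σ} q^{les σ} t^{des σ} = Σ_{σ ∈ S_n} p^{nest σ} q^{cros σ} t^{drop σ}, as polynomials in p, q, t. -/
open Finset MvPolynomial

/-- The value `σ(i)` for a permutation of `{1,…,n}` encoded as `Equiv.Perm (Fin n)`,
with the convention `σ(i) = 0` for `i = 0` and `i = n+1` (indeed for all `i ∉ [n]`). -/
def pval (n : ℕ) (σ : Equiv.Perm (Fin n)) (i : ℕ) : ℕ :=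
  if h : 1 ≤ i ∧ i ≤ n then ((σ ⟨i - 1, by omega⟩ : Fin n) : ℕ) + 1 else 0

/-- Number of inversions: pairs `1 ≤ i < j ≤ n` with `σ(i) > σ(j)`. -/
def inv (n : ℕ) (σ : Equiv.Perm (Fin n)) : ℕ :=
  ((Finset.Icc 1 n ×ˢ Finset.Icc 1 n).filter
    (fun p => p.1 < p.2 ∧ pval n σ p.2 < pval n σ p.1)).card

/-- Number of excedances: indices `i ∈ [n]` with `i < σ(i)`. -/
def exc (n : ℕ) (σ : Equiv.Perm (Fin n)) : ℕ :=
  ((Finset.Icc 1 n).filter (fun i => i < pval n σ i)).card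

/-- Number of drops: indices `i ∈ [n]` with `i > σ(i)`. -/
def drp (n : ℕ) (σ : Equiv.Perm (Fin n)) : ℕ :=
  ((Finset.Icc 1 n).filter (fun i => pval n σ i < i)).card

/-- Number of descents: indices `1 ≤ i < n` with `σ(i) > σ(i+1)`. -/
def des (n : ℕ) (σ : Equiv.Perm (Fin n)) : ℕ :=
  ((Finset.Icc 1 (n - 1)).filter (fun i => pval n σ (i + 1) < pval n σ i)).card

/-- `les σ`: number of pairs `2 ≤ i < j ≤ n` with `σ(i-1) > σ(j) > σ(i)`. -/
def les (n : ℕ) (σ : Equiv.Perm (Fin n)) : ℕ :=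
  ((Finset.Icc 2 n ×ˢ Finset.Icc 2 n).filter
    (fun p => p.1 < p.2 ∧ pval n σ p.2 < pval n σ (p.1 - 1) ∧
      pval n σ p.1 < pval n σ p.2)).card

/-- `res σ`: number of pairs `1 ≤ i < j ≤ n-1` with `σ(j+1) > σ(i) > σ(j)`. -/
def res (n : ℕ) (σ : Equiv.Perm (Fin n)) : ℕ :=
  ((Finset.Icc 1 (n - 1) ×ˢ Finset.Icc 1 (n - 1)).filter
    (fun p => p.1 < p.2 ∧ pval n σ p.2 < pval n σ p.1 ∧
      pval n σ p.1 < pval n σ (p.2 + 1))).card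

/-- `ress σ`: number of pairs `1 ≤ i < j ≤ n-1` with `σ(j+1) < σ(i) < σ(j)`. -/
def ress (n : ℕ) (σ : Equiv.Perm (Fin n)) : ℕ :=
  ((Finset.Icc 1 (n - 1) ×ˢ Finset.Icc 1 (n - 1)).filter
    (fun p => p.1 < p.2 ∧ pval n σ (p.2 + 1) < pval n σ p.1 ∧
      pval n σ p.1 < pval n σ p.2)).card

/-- Crossing number: pairs `(i,j) ∈ [n]×[n]` with `i < j ≤ σ(i) < σ(j)` or
`i > j > σ(i) > σ(j)`. -/
def cros (n : ℕ) (σ : Equiv.Perm (Fin n)) : ℕ :=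
  ((Finset.Icc 1 n ×ˢ Finset.Icc 1 n).filter
    (fun p => (p.1 < p.2 ∧ p.2 ≤ pval n σ p.1 ∧ pval n σ p.1 < pval n σ p.2) ∨
      (p.2 < p.1 ∧ pval n σ p.1 < p.2 ∧ pval n σ p.2 < pval n σ p.1))).card

/-- Nesting number: pairs `(i,j) ∈ [n]×[n]` with `i < j ≤ σ(j) < σ(i)` or
`i > j > σ(j) > σ(i)`. -/
def nest (n : ℕ) (σ : Equiv.Perm (Fin n)) : ℕ :=
  ((Finset.Icc 1 n ×ˢ Finset.Icc 1 n).filter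
    (fun p => (p.1 < p.2 ∧ p.2 ≤ pval n σ p.2 ∧ pval n σ p.2 < pval n σ p.1) ∨
      (p.2 < p.1 ∧ pval n σ p.2 < p.2 ∧ pval n σ p.1 < pval n σ p.2))).card

/-- Number of valleys: `i ∈ [n]` with `σ(i-1) > σ(i)` and `σ(i) < σ(i+1)`
(convention `σ(0) = σ(n+1) = 0`). -/
def valleys (n : ℕ) (σ : Equiv.Perm (Fin n)) : ℕ :=
  ((Finset.Icc 1 n).filter
    (fun i => pval n σ i < pval n σ (i - 1) ∧ pval n σ i < pval n σ (i + 1))).card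

/-- Number of double descents: `i ∈ [n]` with `σ(i-1) > σ(i)` and `σ(i) > σ(i+1)`
(convention `σ(0) = σ(n+1) = 0`). -/
def ddes (n : ℕ) (σ : Equiv.Perm (Fin n)) : ℕ :=
  ((Finset.Icc 1 n).filter
    (fun i => pval n σ i < pval n σ (i - 1) ∧ pval n σ (i + 1) < pval n σ i)).card

/-- `S_{n,k}`: permutations of `[n]` with exactly `k` valleys and no double descents. -/
def Snk (n k : ℕ) : Finset (Equiv.Perm (Fin n)) :=
  Finset.univ.filter (fun σ => valleys n σ = k ∧ ddes n σ = 0)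

/-! ### Weighted lattice paths -/

section Histories

variable {α R : Type*} [CommSemiring R]

/-- The product of the weights of the steps of a path starting at height `h`. -/
def pathWeight (next : ℕ → α → ℕ) (w : ℕ → α → R) : ℕ → List α → R
  | _, [] => 1
  | h, a :: l => w h a * pathWeight next w (next h a) l

/-- The total weight of the paths of length `n` from height `h` to height `0`. -/
def pathTotal (steps : ℕ → Finset α) (next : ℕ → α → ℕ) (w : ℕ → α → R) : ℕ → ℕ → R
  | 0, h => if h = 0 then 1 else 0
  | n + 1, h => ∑ a ∈ steps h, w h a * pathTotal steps next w n (next h a)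

theorem pathWeight_map_range {next : ℕ → α → ℕ} (w : ℕ → α → R) {n : ℕ}
    {label : ℕ → α} {height : ℕ → ℕ}
    (hnext : ∀ k < n, height (k + 1) = next (height k) (label k)) :
    pathWeight next w (height 0) ((List.range n).map label) =
      ∏ k ∈ range n, w (height k) (label k) := by
  induction n generalizing label height with
  | zero => simp [pathWeight]
  | succ n ih =>
    rw [List.range_succ_eq_map, List.map_cons, List.map_map, pathWeight, prod_range_succ',
      mul_comm, ← hnext 0 n.succ_pos]
    congr 1
    exact ih (label := label ∘ Nat.succ) (height := height ∘ Nat.succ)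
      fun k hk => hnext (k + 1) (by omega)

variable [DecidableEq α]

/-- Label sequences of the paths of length `n` from height `h` to height `0`, where `steps h` are
the labels allowed at height `h` and `next h a` is the height reached by the step labelled `a`. -/
def histories (steps : ℕ → Finset α) (next : ℕ → α → ℕ) : ℕ → ℕ → Finset (List α)
  | 0, h => if h = 0 then {[]} else ∅
  | n + 1, h => (steps h).biUnion fun a =>
      (histories steps next n (next h a)).image (List.cons a)

theorem sum_histories (steps : ℕ → Finset α) (next : ℕ → α → ℕ) (w : ℕ → α → R) (n h : ℕ) :
    ∑ l ∈ histories steps next n h, pathWeight next w h l = pathTotal steps next w n h := by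
  induction n generalizing h with
  | zero => by_cases hh : h = 0 <;> simp [histories, pathTotal, pathWeight, hh]
  | succ n ih =>
    rw [histories, pathTotal, sum_biUnion]
    · refine sum_congr rfl fun a _ => ?_
      rw [sum_image (by simp), ← ih, mul_sum]
      rfl
    · intro a _ b _ hab
      rw [Function.onFun, disjoint_left]
      simp only [mem_image]
      rintro _ ⟨l, _, rfl⟩ ⟨l', _, h'⟩
      exact hab (List.cons.inj h').1.symm

theorem card_histories (steps : ℕ → Finset α) (next : ℕ → α → ℕ) (n h : ℕ) :
    #(histories steps next n h) = pathTotal steps next (fun _ _ => (1 : ℕ)) n h := by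
  have hw : ∀ (l : List α) (h : ℕ), pathWeight next (fun _ _ => (1 : ℕ)) h l = 1 := by
    intro l
    induction l with
    | nil => intro h; rfl
    | cons a l ih => intro h; simp [pathWeight, ih]
  rw [← sum_histories, card_eq_sum_ones]
  exact sum_congr rfl fun l _ => (hw l h).symm

theorem map_range_mem_histories {steps : ℕ → Finset α} {next : ℕ → α → ℕ} {n : ℕ}
    {label : ℕ → α} {height : ℕ → ℕ} (hend : height n = 0)
    (hmem : ∀ k < n, label k ∈ steps (height k))
    (hnext : ∀ k < n, height (k + 1) = next (height k) (label k)) :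
    (List.range n).map label ∈ histories steps next n (height 0) := by
  induction n generalizing label height with
  | zero => simp [histories, hend]
  | succ n ih =>
    rw [List.range_succ_eq_map, List.map_cons, List.map_map, histories, mem_biUnion]
    refine ⟨label 0, hmem 0 n.succ_pos, mem_image_of_mem _ ?_⟩
    rw [← hnext 0 n.succ_pos]
    exact ih (label := label ∘ Nat.succ) (height := height ∘ Nat.succ) hend
      (fun k hk => hmem (k + 1) (by omega)) fun k hk => hnext (k + 1) (by omega)

/-- If the elements of `Ω` are encoded injectively by weighted paths and there are as many
elements as paths, then summing over `Ω` amounts to summing over all paths. -/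
theorem sum_prod_eq_pathTotal {Ω : Type*} [Fintype Ω] {steps : ℕ → Finset α}
    {next : ℕ → α → ℕ} (w : ℕ → α → R) {n h₀ : ℕ} (label : Ω → ℕ → α) (height : Ω → ℕ → ℕ)
    (hstart : ∀ ω, height ω 0 = h₀) (hend : ∀ ω, height ω n = 0)
    (hmem : ∀ ω, ∀ k < n, label ω k ∈ steps (height ω k))
    (hnext : ∀ ω, ∀ k < n, height ω (k + 1) = next (height ω k) (label ω k))
    (hinj : ∀ ω ω', (∀ k < n, label ω k = label ω' k) → ω = ω')
    (hcard : Fintype.card Ω = pathTotal steps next (fun _ _ => (1 : ℕ)) n h₀) :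
    ∑ ω, ∏ k ∈ range n, w (height ω k) (label ω k) = pathTotal steps next w n h₀ := by
  have hcode : Function.Injective fun ω => (List.range n).map (label ω) := by
    intro ω ω' h
    refine hinj ω ω' fun k hk => ?_
    exact List.map_inj_left.1 h k (List.mem_range.2 hk)
  have himage : univ.image (fun ω => (List.range n).map (label ω)) =
      histories steps next n h₀ := by
    refine eq_of_subset_of_card_le ?_ ?_
    · intro l hl
      obtain ⟨ω, _, rfl⟩ := mem_image.1 hl
      exact hstart ω ▸ map_range_mem_histories (hend ω) (hmem ω) (hnext ω)
    · rw [card_histories, ← hcard, card_image_of_injective _ hcode, card_univ]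
  rw [← sum_histories, ← himage, sum_image hcode.injOn]
  refine sum_congr rfl fun ω _ => ?_
  rw [← hstart ω, pathWeight_map_range w (hnext ω)]

end Histories

/-! ### The two path models -/

section Models

variable {R : Type*} [CommSemiring R]

/-- The `(p, q)`-analogue of `h`. -/
def pqNat (p q : R) (h : ℕ) : R := ∑ g ∈ range h, p ^ (h - 1 - g) * q ^ g

theorem pqNat_zero (p q : R) : pqNat p q 0 = 0 := by simp [pqNat]

theorem pqNat_comm (p q : R) (h : ℕ) : pqNat q p h = pqNat p q h := by
  rw [pqNat, pqNat, ← sum_range_reflect]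
  refine sum_congr rfl fun g hg => ?_
  rw [mem_range] at hg
  rw [mul_comm, show h - 1 - (h - 1 - g) = g by omega]

/-- Labels of Motzkin steps: an index of a gap, and two bits which determine the direction. -/
def motzkinSteps (h : ℕ) : Finset (ℕ × Bool × Bool) := range h ×ˢ univ

/-- The height after a Motzkin step. -/
def motzkinNext (h : ℕ) (a : ℕ × Bool × Bool) : ℕ := h + a.2.1.toNat - (!a.2.2).toNat

/-- The weight of a Motzkin step. -/
def motzkinWeight (p q t : R) (h : ℕ) (a : ℕ × Bool × Bool) : R :=
  p ^ (h - 1 - a.1) * q ^ a.1 * t ^ a.2.1.toNat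

/-- Labels of Dyck steps: up-steps are labelled by `none`. -/
def dyckSteps (h : ℕ) : Finset (Option ℕ) := insertNone (range ((h + 1) / 2))

/-- The height after a Dyck step. -/
def dyckNext (h : ℕ) : Option ℕ → ℕ
  | none => h + 1
  | some _ => h - 1

/-- The weight of a Dyck step. -/
def dyckWeight (p q t : R) (h : ℕ) : Option ℕ → R
  | none => 1
  | some g => (if h % 2 = 0 then t else 1) * (p ^ g * q ^ ((h + 1) / 2 - 1 - g))

/-- The generating function of Motzkin paths from height `h` to height `0`. -/
abbrev motzkinTotal (p q t : R) : ℕ → ℕ → R :=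
  pathTotal motzkinSteps motzkinNext (motzkinWeight p q t)

/-- The generating function of Dyck paths from height `h` to height `0`. -/
abbrev dyckTotal (p q t : R) : ℕ → ℕ → R :=
  pathTotal dyckSteps dyckNext (dyckWeight p q t)

theorem motzkinTotal_succ (p q t : R) (n h : ℕ) :
    motzkinTotal p q t (n + 1) h = pqNat p q h * (t * motzkinTotal p q t n (h + 1) +
      (1 + t) * motzkinTotal p q t n h + motzkinTotal p q t n (h - 1)) := by
  rw [motzkinTotal, pathTotal, motzkinSteps, sum_product, pqNat, sum_mul]
  refine sum_congr rfl fun g _ => ?_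
  simp [Fintype.sum_prod_type, motzkinWeight, motzkinNext]
  ring

theorem dyckTotal_succ (p q t : R) (n h : ℕ) :
    dyckTotal p q t (n + 1) h = dyckTotal p q t n (h + 1) +
      (if h % 2 = 0 then t else 1) * pqNat p q ((h + 1) / 2) * dyckTotal p q t n (h - 1) := by
  rw [dyckTotal, pathTotal, dyckSteps, insertNone, ← pqNat_comm, pqNat, mul_sum, sum_mul]
  simp [dyckWeight, dyckNext, mul_comm, mul_left_comm]

theorem dyckTotal_odd (p q t : R) (n j : ℕ) :
    dyckTotal p q t (2 * n + 1) (2 * j + 1) =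
      t ^ j * (∏ i ∈ range j, pqNat p q (i + 1)) * motzkinTotal p q t (n + 1) (j + 1) := by
  induction n generalizing j with
  | zero =>
    rw [motzkinTotal_succ, dyckTotal_succ]
    rcases j with _ | j <;> simp [pathTotal, pqNat]
  | succ n ih =>
    have h1 : (2 * j + 1 + 1) / 2 = j + 1 := by omega
    have h2 : (2 * j + 1) % 2 ≠ 0 := by omega
    have h3 : (2 * j + 1 + 1) % 2 = 0 := by omega
    have h4 : (2 * j + 1 + 1 + 1) / 2 = j + 1 := by omega
    have h5 : 2 * j % 2 = 0 := by omega
    have h6 : (2 * j + 1) / 2 = j := by omega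
    rw [motzkinTotal_succ, show 2 * (n + 1) + 1 = (2 * n + 1) + 1 + 1 by ring, dyckTotal_succ,
      dyckTotal_succ, dyckTotal_succ _ _ _ _ (2 * j + 1 - 1)]
    simp only [Nat.add_sub_cancel, h1, h2, h3, h4, h5, h6, if_true, if_false]
    rw [show 2 * j + 1 + 1 + 1 = 2 * (j + 1) + 1 by ring, ih, ih, prod_range_succ]
    rcases j with _ | j
    · simp [pqNat_zero, motzkinTotal_succ]
      ring
    · rw [show 2 * (j + 1) - 1 = 2 * j + 1 by omega, ih, prod_range_succ]
      ring

theorem dyckTotal_zero (p q t : R) (n : ℕ) :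
    dyckTotal p q t (2 * (n + 1)) 0 = motzkinTotal p q t (n + 1) 1 := by
  rw [show 2 * (n + 1) = 2 * n + 1 + 1 by ring, dyckTotal_succ]
  simpa [pqNat_zero] using dyckTotal_odd p q t n 0

theorem motzkinTotal_one (n h : ℕ) :
    motzkinTotal (1 : ℕ) 1 1 (n + 1) (h + 1) = (n + 1).factorial * n.choose h := by
  have hpq : ∀ h, pqNat (1 : ℕ) 1 h = h := by simp [pqNat]
  induction n generalizing h with
  | zero =>
    rw [motzkinTotal_succ, hpq]
    rcases h with _ | h <;> simp [pathTotal]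
  | succ n ih =>
    have key := Nat.add_one_mul_choose_eq (n + 1) h
    rw [motzkinTotal_succ, hpq, ih, ih, Nat.factorial_succ (n + 1), mul_comm (n + 1 + 1), mul_assoc,
      key]
    rcases h with _ | h
    · have h0 : motzkinTotal (1 : ℕ) 1 1 (n + 1) 0 = 0 := by
        rw [motzkinTotal_succ, hpq, zero_mul]
      simp [h0]
      ring
    · rw [Nat.add_sub_cancel, ih, Nat.choose_succ_succ (n + 1), Nat.choose_succ_succ n,
        Nat.choose_succ_succ n (h + 1)]
      simp only [Nat.succ_eq_add_one]
      ring

theorem motzkin_count (n : ℕ) :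
    pathTotal motzkinSteps motzkinNext (fun _ _ => (1 : ℕ)) (n + 1) 1 = (n + 1).factorial := by
  have := motzkinTotal_one n 0
  have hw : motzkinWeight (1 : ℕ) 1 1 = fun _ _ => 1 := by
    ext h a
    simp [motzkinWeight]
  simpa [motzkinTotal, hw] using this

theorem dyck_count (n : ℕ) :
    pathTotal dyckSteps dyckNext (fun _ _ => (1 : ℕ)) (2 * (n + 1)) 0 = (n + 1).factorial := by
  have := dyckTotal_zero (1 : ℕ) 1 1 n
  have hw : dyckWeight (1 : ℕ) 1 1 = fun _ _ => 1 := by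
    ext h a
    cases a <;> simp [dyckWeight]
  rw [motzkinTotal_one n 0] at this
  simpa [dyckTotal, hw] using this

end Models

/-! ### Permutations of `{1, …, n}` as pairs of inverse functions -/

/-- `s` and `r` restrict to mutually inverse permutations of `{1, …, n}` and vanish elsewhere. -/
structure InversePair (n : ℕ) (s r : ℕ → ℕ) : Prop where
  left : ∀ i, 1 ≤ i → i ≤ n → 1 ≤ s i ∧ s i ≤ n ∧ r (s i) = i
  right : ∀ i, 1 ≤ i → i ≤ n → 1 ≤ r i ∧ r i ≤ n ∧ s (r i) = i
  left_zero : s 0 = 0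
  right_zero : r 0 = 0
  left_out : ∀ i, n < i → s i = 0
  right_out : ∀ i, n < i → r i = 0

theorem pval_mul_cancel {n : ℕ} {σ τ : Equiv.Perm (Fin n)} (h : ∀ i, τ (σ i) = i) (i : ℕ)
    (h1 : 1 ≤ i) (h2 : i ≤ n) :
    1 ≤ pval n σ i ∧ pval n σ i ≤ n ∧ pval n τ (pval n σ i) = i := by
  have hi : pval n σ i = (σ ⟨i - 1, by omega⟩ : ℕ) + 1 := dif_pos ⟨h1, h2⟩
  have hlt := (σ ⟨i - 1, by omega⟩).2
  refine ⟨by omega, by omega, ?_⟩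
  rw [hi, pval, dif_pos (by omega)]
  simp only [Nat.add_sub_cancel, Fin.eta, h]
  omega

theorem inversePair_pval (n : ℕ) (σ : Equiv.Perm (Fin n)) :
    InversePair n (pval n σ) (pval n σ⁻¹) where
  left := pval_mul_cancel (by simp)
  right := pval_mul_cancel (by simp)
  left_zero := dif_neg (by omega)
  right_zero := dif_neg (by omega)
  left_out _ _ := dif_neg (by omega)
  right_out _ _ := dif_neg (by omega)

theorem pval_injective (n : ℕ) {σ τ : Equiv.Perm (Fin n)}
    (h : ∀ i, 1 ≤ i → i ≤ n → pval n σ i = pval n τ i) : σ = τ := by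
  ext i
  have := h (i + 1) (by omega) (by omega)
  rw [pval, pval, dif_pos (by omega), dif_pos (by omega)] at this
  simpa using this

theorem card_filter_product {α β : Type*} (A : Finset α) (B : Finset β) (P : α × β → Prop)
    [DecidablePred P] :
    #{x ∈ A ×ˢ B | P x} = ∑ j ∈ B, #{i ∈ A | P (i, j)} := by
  simp only [card_filter]
  rw [sum_product_right]

theorem prod_pow_mul_pow_mul_pow {ι R : Type*} [CommSemiring R] (A : Finset ι) (p q t : R)
    (a b c : ι → ℕ) : ∏ i ∈ A, p ^ a i * q ^ b i * t ^ c i =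
      p ^ (∑ i ∈ A, a i) * q ^ (∑ i ∈ A, b i) * t ^ (∑ i ∈ A, c i) := by
  simp only [prod_mul_distrib, prod_pow_eq_pow_sum]

theorem prod_range_add_one {M : Type*} [CommMonoid M] (f : ℕ → M) (n : ℕ) :
    ∏ k ∈ range n, f (k + 1) = ∏ k ∈ Icc 1 n, f k := by
  rw [range_eq_Ico, prod_Ico_add', zero_add]
  rfl

namespace InversePair

variable {n : ℕ} {s r s' r' : ℕ → ℕ}

theorem symm (H : InversePair n s r) : InversePair n r s :=
  ⟨H.right, H.left, H.right_zero, H.left_zero, H.right_out, H.left_out⟩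

theorem sum_comp (H : InversePair n s r) {M : Type*} [AddCommMonoid M] (F : ℕ → ℕ → M) :
    ∑ i ∈ Icc 1 n, F i (s i) = ∑ v ∈ Icc 1 n, F (r v) v := by
  refine sum_nbij' s r ?_ ?_ ?_ ?_ ?_
  · intro i hi
    have := H.left i (mem_Icc.1 hi).1 (mem_Icc.1 hi).2
    exact mem_Icc.2 ⟨this.1, this.2.1⟩
  · intro i hi
    have := H.right i (mem_Icc.1 hi).1 (mem_Icc.1 hi).2
    exact mem_Icc.2 ⟨this.1, this.2.1⟩
  · intro i hi
    exact (H.left i (mem_Icc.1 hi).1 (mem_Icc.1 hi).2).2.2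
  · intro i hi
    exact (H.right i (mem_Icc.1 hi).1 (mem_Icc.1 hi).2).2.2
  · intro i hi
    rw [(H.left i (mem_Icc.1 hi).1 (mem_Icc.1 hi).2).2.2]

theorem card_comp (H : InversePair n s r) (P : ℕ → ℕ → Prop) [∀ i, DecidablePred (P i)] :
    #{i ∈ Icc 1 n | P i (s i)} = #{v ∈ Icc 1 n | P (r v) v} := by
  simp only [card_filter]
  exact H.sum_comp fun i v => if P i v then 1 else 0

end InversePair

/-! ### The code of a permutation recording `les` and `res` -/

/-- The contribution of the value `k` to `les`. -/
def lesAt (n : ℕ) (s r : ℕ → ℕ) (k : ℕ) : ℕ :=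
  #{j ∈ range (n + 1) | j + 1 < r k ∧ k < s j ∧ s (j + 1) < k}

/-- The contribution of the value `k` to `res`. -/
def resAt (n : ℕ) (s r : ℕ → ℕ) (k : ℕ) : ℕ :=
  #{j ∈ range (n + 1) | r k < j ∧ s j < k ∧ k < s (j + 1)}

/-- The number of descents from values at least `k` to values less than `k`. -/
def crossingDescents (n : ℕ) (s : ℕ → ℕ) (k : ℕ) : ℕ :=
  #{j ∈ range (n + 1) | k ≤ s j ∧ s (j + 1) < k}

/-- The Motzkin label of the value `k`. -/
def motzkinLabel (n : ℕ) (s r : ℕ → ℕ) (k : ℕ) : ℕ × Bool × Bool :=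
  (lesAt n s r k, decide (k < s (r k - 1)), decide (k < s (r k + 1)))

theorem card_falls_add (b : ℕ → Prop) [DecidablePred b] {a m : ℕ} (h : a ≤ m) :
    #{j ∈ Ico a m | b j ∧ ¬b (j + 1)} + (if b m then 1 else 0) =
      #{j ∈ Ico a m | ¬b j ∧ b (j + 1)} + (if b a then 1 else 0) := by
  induction m, h using Nat.le_induction with
  | base => simp
  | succ m h ih =>
    simp only [card_filter, sum_Ico_succ_top h] at ih ⊢
    by_cases h1 : b m <;> by_cases h2 : b (m + 1) <;> simp [h1, h2] at ih ⊢ <;> omega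

namespace InversePair

variable {n : ℕ} {s r s' r' : ℕ → ℕ}

theorem crossingDescents_eq (H : InversePair n s r) {k : ℕ} (h1 : 1 ≤ k) (h2 : k ≤ n) :
    crossingDescents n s k = lesAt n s r k + 1 + resAt n s r k := by
  obtain ⟨hr1, hr2, hsr⟩ := H.right k h1 h2
  have key := card_falls_add (fun j => k ≤ s j) (a := r k) (m := n + 1) (by omega)
  rw [if_neg (by rw [H.left_out _ (by omega)]; omega), if_pos hsr.ge] at key
  have hres : resAt n s r k = #{j ∈ Ico (r k) (n + 1) | ¬k ≤ s j ∧ k ≤ s (j + 1)} := by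
    rw [resAt]
    congr 1
    ext j
    simp only [mem_filter, mem_range, mem_Ico]
    have hne : s (j + 1) = k → j < n → r k = j + 1 := fun h hj => by
      rw [← h, (H.left (j + 1) (by omega) (by omega)).2.2]
    have hout : j = n → s (j + 1) = 0 := fun h => H.left_out _ (by omega)
    have hj : j = r k → s j = k := fun h => h ▸ hsr
    omega
  have hles : lesAt n s r k = #{j ∈ Ico 0 (r k) | k ≤ s j ∧ ¬k ≤ s (j + 1)} := by
    rw [lesAt]
    congr 1
    ext j
    simp only [mem_filter, mem_range, mem_Ico]
    have hne : s j = k → j < r k → r k = j := fun h hj => by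
      rcases Nat.eq_zero_or_pos j with rfl | hj0
      · rw [H.left_zero] at h
        omega
      · rw [← h, (H.left j (by omega) (by omega)).2.2]
    have hj : j + 1 = r k → s (j + 1) = k := fun h => h ▸ hsr
    omega
  rw [hres, hles, add_assoc, add_comm 1, ← key, add_zero, crossingDescents, range_eq_Ico]
  simp only [card_filter, not_le]
  exact (sum_Ico_consecutive _ (Nat.zero_le _) (by omega)).symm

theorem crossingDescents_succ (H : InversePair n s r) {k : ℕ} (h1 : 1 ≤ k) (h2 : k ≤ n) :
    crossingDescents n s (k + 1) =
      motzkinNext (crossingDescents n s k) (motzkinLabel n s r k) := by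
  obtain ⟨hr1, hr2, hsr⟩ := H.right k h1 h2
  have hne : ∀ j, s j = k ↔ j = r k := fun j => by
    refine ⟨fun h => ?_, fun h => h ▸ hsr⟩
    by_cases hj : 1 ≤ j ∧ j ≤ n
    · rw [← h, (H.left j hj.1 hj.2).2.2]
    · rcases Nat.eq_zero_or_pos j with rfl | hj0
      · rw [H.left_zero] at h
        omega
      · rw [H.left_out j (by omega)] at h
        omega
  have key : crossingDescents n s (k + 1) + (if k < s (r k + 1) then 0 else 1) =
      crossingDescents n s k + (if k < s (r k - 1) then 1 else 0) := by
    have e1 : (if k < s (r k + 1) then 0 else 1) =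
        ∑ j ∈ range (n + 1), if j = r k ∧ ¬k < s (j + 1) then 1 else 0 := by
      rw [sum_eq_single (r k)]
      · by_cases h : k < s (r k + 1) <;> simp [h]
      · intro j _ hj
        simp [hj]
      · intro h
        rw [mem_range] at h
        omega
    have e2 : (if k < s (r k - 1) then 1 else 0) =
        ∑ j ∈ range (n + 1), if j + 1 = r k ∧ k < s j then 1 else 0 := by
      rw [sum_eq_single (r k - 1)]
      · rw [Nat.sub_add_cancel hr1]
        by_cases h : k < s (r k - 1) <;> simp [h]
      · intro j _ hj
        rw [if_neg]
        omega
      · intro h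
        rw [mem_range] at h
        omega
    rw [e1, e2, crossingDescents, crossingDescents, card_filter, card_filter,
      ← sum_add_distrib, ← sum_add_distrib]
    refine sum_congr rfl fun j _ => ?_
    have hj := hne j
    have hj' := hne (j + 1)
    split_ifs <;> omega
  simp only [motzkinNext, motzkinLabel]
  by_cases h : k < s (r k + 1) <;> by_cases h' : k < s (r k - 1) <;>
    simp [h, h'] at key ⊢ <;> omega

/-- Whether the value `b < k` is preceded by a value at least `k` is determined by the labels and
the relative order of the values less than `k`. -/
theorem le_pred_iff (H : InversePair n s r) {b k : ℕ} (h1 : 1 ≤ b) (hb : b < k) (hk : k ≤ n + 1) :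
    k ≤ s (r b - 1) ↔ b < s (r b - 1) ∧ ¬∃ a, b < a ∧ a < k ∧ ¬a < s (r a + 1) ∧ r a < r b ∧
      ∀ c, 1 ≤ c → c < a → r a < r c → ¬r c < r b := by
  obtain ⟨hr1, hr2, hsr⟩ := H.right b h1 (by omega)
  constructor
  · refine fun h => ⟨by omega, ?_⟩
    rintro ⟨a, hba, hak, hsucc, hab, hc⟩
    obtain ⟨ha1, ha2, hsa⟩ := H.right a (by omega) (by omega)
    obtain ⟨hc1, hc2, hrc⟩ := H.left (r a + 1) (by omega) (by omega)
    have hne : s (r a + 1) ≠ a := fun h => by rw [h] at hrc; omega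
    have := hc _ hc1 (by omega) (by omega)
    rw [hrc] at this
    have : r b - 1 = r a := by omega
    rw [this] at h
    omega
  · rintro ⟨hlt, hno⟩
    by_contra hk'
    have hpos : 1 ≤ r b - 1 := by
      by_contra h0
      rw [show r b - 1 = 0 by omega, H.left_zero] at hlt
      omega
    obtain ⟨ha1, ha2, hra⟩ := H.left (r b - 1) hpos (by omega)
    refine hno ⟨s (r b - 1), hlt, by omega, ?_, by omega, fun c _ _ _ => by omega⟩
    rw [hra, Nat.sub_add_cancel hr1, hsr]
    omega

theorem lesAt_eq (H : InversePair n s r) {k : ℕ} (h1 : 1 ≤ k) (h2 : k ≤ n) :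
    lesAt n s r k = #{b ∈ Icc 1 n | (b < k ∧ k ≤ s (r b - 1)) ∧ r b < r k} := by
  obtain ⟨hr1, hr2, hsr⟩ := H.right k h1 h2
  rw [← H.card_comp fun i v => (v < k ∧ k ≤ s (i - 1)) ∧ i < r k, lesAt]
  refine card_bij (fun j _ => j + 1) ?_ (fun a _ b _ h => by omega) ?_
  · intro j hj
    rw [mem_filter, mem_range] at hj
    rw [mem_filter, mem_Icc, Nat.add_sub_cancel]
    omega
  · intro i hi
    rw [mem_filter, mem_Icc] at hi
    have hne : s (i - 1) ≠ k := fun h => by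
      have h0 : i - 1 ≠ 0 := fun h0 => by
        rw [h0, H.left_zero] at h
        omega
      have := (H.left (i - 1) (by omega) (by omega)).2.2
      rw [h] at this
      omega
    refine ⟨i - 1, ?_, by omega⟩
    rw [mem_filter, mem_range, Nat.sub_add_cancel hi.1.1]
    omega

theorem lt_iff_card_le (H : InversePair n s r) {a k : ℕ} (ha : 1 ≤ a) (hak : a < k) (hk : k ≤ n) :
    r a < r k ↔ #{b ∈ Icc 1 n | (b < k ∧ k ≤ s (r b - 1)) ∧ ¬r a < r b} ≤ lesAt n s r k := by
  rw [H.lesAt_eq (by omega) hk]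
  obtain ⟨hr1, hr2, hsr⟩ := H.right k (by omega) hk
  obtain ⟨hra1, hra2, hsra⟩ := H.right a ha (by omega)
  have hne : r a ≠ r k := fun h => by
    rw [h] at hsra
    omega
  constructor
  · intro h
    refine card_le_card (monotone_filter_right _ fun b _ hb => ⟨hb.1, by omega⟩)
  · intro h
    by_contra hlt
    refine absurd h (not_le.2 (card_lt_card ?_))
    have hex : ∃ i, r k < i ∧ s i < k := ⟨r a, by omega, by omega⟩
    obtain ⟨hi1, hi2⟩ := Nat.find_spec hex
    have hile : Nat.find hex ≤ r a := Nat.find_min' hex ⟨by omega, by omega⟩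
    have hpred : k ≤ s (Nat.find hex - 1) := by
      rcases Nat.lt_or_ge (r k) (Nat.find hex - 1) with h' | h'
      · have := Nat.find_min hex (m := Nat.find hex - 1) (by omega)
        omega
      · rw [show Nat.find hex - 1 = r k by omega, hsr]
    obtain ⟨hs1, hs2, hrs⟩ := H.left (Nat.find hex) (by omega) (by omega)
    refine (ssubset_iff_of_subset (monotone_filter_right _ fun b _ hb => ⟨hb.1, by omega⟩)).2
      ⟨s (Nat.find hex), ?_, ?_⟩
    · rw [mem_filter, mem_Icc, hrs]
      omega
    · rw [mem_filter, hrs]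
      omega

theorem lt_iff_lt_of_motzkinLabel_eq (H : InversePair n s r) (H' : InversePair n s' r')
    (h : ∀ k, 1 ≤ k → k ≤ n → motzkinLabel n s r k = motzkinLabel n s' r' k) (k : ℕ)
    (hk : k ≤ n + 1) :
    ∀ a b, 1 ≤ a → 1 ≤ b → a < k → b < k → (r a < r b ↔ r' a < r' b) := by
  simp only [motzkinLabel, Prod.mk.injEq, decide_eq_decide] at h
  induction k with
  | zero => intro a b _ _ ha; omega
  | succ k ih =>
    have ih := ih (by omega)
    have hblock : ∀ b, 1 ≤ b → b < k → (k ≤ s (r b - 1) ↔ k ≤ s' (r' b - 1)) := by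
      intro b hb hbk
      rw [H.le_pred_iff hb hbk (by omega), H'.le_pred_iff hb hbk (by omega),
        (h b hb (by omega)).2.1]
      refine and_congr_right fun _ => not_congr (exists_congr fun a => and_congr_right fun h1 =>
        and_congr_right fun h2 => and_congr (not_congr (h a (by omega) (by omega)).2.2)
        (and_congr (ih a b (by omega) hb h2 hbk) ?_))
      exact forall_congr' fun c => forall_congr' fun hc => forall_congr' fun hca =>
        imp_congr (ih a c (by omega) hc h2 (by omega))
          (not_congr (ih c b hc hb (by omega) hbk))
    have hnew : ∀ a, 1 ≤ a → a < k → (r a < r k ↔ r' a < r' k) := by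
      intro a ha hak
      rw [H.lt_iff_card_le ha hak (by omega), H'.lt_iff_card_le ha hak (by omega),
        (h k (by omega) (by omega)).1]
      suffices {b ∈ Icc 1 n | (b < k ∧ k ≤ s (r b - 1)) ∧ ¬r a < r b} =
          {b ∈ Icc 1 n | (b < k ∧ k ≤ s' (r' b - 1)) ∧ ¬r' a < r' b} by rw [this]
      refine filter_congr fun b hb => ?_
      have hb1 := (mem_Icc.1 hb).1
      rw [and_assoc, and_assoc]
      exact and_congr_right fun hbk => and_congr (hblock b hb1 hbk)
        (not_congr (ih a b ha hb1 hak hbk))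
    have hne : ∀ a, 1 ≤ a → a < k → r a ≠ r k ∧ r' a ≠ r' k := by
      intro a ha hak
      have h1 := (H.right a ha (by omega)).2.2
      have h2 := (H.right k (by omega) (by omega)).2.2
      have h1' := (H'.right a ha (by omega)).2.2
      have h2' := (H'.right k (by omega) (by omega)).2.2
      constructor <;> intro he
      · rw [he] at h1
        omega
      · rw [he] at h1'
        omega
    intro a b ha hb hak hbk
    rcases Nat.lt_succ_iff_lt_or_eq.1 hak with hak | rfl <;>
      rcases Nat.lt_succ_iff_lt_or_eq.1 hbk with hbk | rfl
    · exact ih a b ha hb hak hbk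
    · exact hnew a ha hak
    · have := hnew b hb hbk
      have := hne b hb hbk
      omega
    · simp

theorem eq_of_motzkinLabel_eq (H : InversePair n s r) (H' : InversePair n s' r')
    (h : ∀ k, 1 ≤ k → k ≤ n → motzkinLabel n s r k = motzkinLabel n s' r' k) :
    ∀ k, 1 ≤ k → k ≤ n → r k = r' k := by
  have hpos : ∀ {s r : ℕ → ℕ}, InversePair n s r → ∀ k, 1 ≤ k → k ≤ n →
      r k = #{b ∈ Icc 1 n | ¬r k < r b} := by
    intro s r H k h1 h2
    rw [← H.card_comp fun i _ => ¬r k < i]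
    have : {i ∈ Icc 1 n | ¬r k < i} = Icc 1 (r k) := by
      ext i
      have := (H.right k h1 h2).2.1
      simp only [mem_filter, mem_Icc]
      omega
    rw [this, Nat.card_Icc, Nat.add_sub_cancel]
  intro k h1 h2
  rw [hpos H k h1 h2, hpos H' k h1 h2]
  congr 1
  refine filter_congr fun b hb => ?_
  rw [mem_Icc] at hb
  rw [H.lt_iff_lt_of_motzkinLabel_eq H' h (n + 1) le_rfl k b h1 hb.1 (by omega) (by omega)]

end InversePair

theorem les_eq_sum (n : ℕ) (σ : Equiv.Perm (Fin n)) :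
    les n σ = ∑ k ∈ Icc 1 n, lesAt n (pval n σ) (pval n σ⁻¹) k := by
  have H := inversePair_pval n σ
  simp only [les, lesAt]
  rw [← H.sum_comp fun j k => #{i ∈ range (n + 1) |
    i + 1 < j ∧ k < pval n σ i ∧ pval n σ (i + 1) < k}, card_filter_product]
  refine sum_subset_zero_on_sdiff (Icc_subset_Icc_left (by omega)) ?_ ?_
  · intro j hj
    simp only [mem_sdiff, mem_Icc] at hj
    rw [card_eq_zero, filter_eq_empty_iff]
    intro i _
    omega
  · intro j hj
    rw [mem_Icc] at hj
    symm
    refine card_bij (fun i _ => i + 1) ?_ (fun a _ b _ h => by omega) ?_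
    · intro i hi
      have h0 : i = 0 → pval n σ i = 0 := fun h => h ▸ H.left_zero
      simp only [mem_filter, mem_Icc, mem_range, Nat.add_sub_cancel] at hi ⊢
      omega
    · intro i hi
      simp only [mem_filter, mem_Icc, mem_range] at hi ⊢
      refine ⟨i - 1, ?_, by omega⟩
      rw [Nat.sub_add_cancel (by omega)]
      omega

theorem res_eq_sum (n : ℕ) (σ : Equiv.Perm (Fin n)) :
    res n σ = ∑ k ∈ Icc 1 n, resAt n (pval n σ) (pval n σ⁻¹) k := by
  have H := inversePair_pval n σ
  simp only [res, resAt]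
  rw [← H.sum_comp fun i k => #{j ∈ range (n + 1) |
    i < j ∧ pval n σ j < k ∧ k < pval n σ (j + 1)}]
  have hswap : ∀ i, #{j ∈ range (n + 1) | i < j ∧ pval n σ j < pval n σ i ∧
      pval n σ i < pval n σ (j + 1)} = #{j ∈ Icc 1 (n - 1) | i < j ∧ pval n σ j < pval n σ i ∧
      pval n σ i < pval n σ (j + 1)} := by
    intro i
    congr 1
    ext j
    simp only [mem_filter, mem_Icc, mem_range]
    have hout : j = n → pval n σ (j + 1) = 0 := fun h => H.left_out _ (by omega)
    omega
  simp only [hswap, card_filter]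
  rw [sum_product]
  refine sum_subset (Icc_subset_Icc_right (by omega)) ?_
  intro i hi hi'
  refine sum_eq_zero fun j hj => if_neg ?_
  simp only [mem_Icc] at hi hi' hj
  omega

theorem des_eq_sum (n : ℕ) (σ : Equiv.Perm (Fin n)) :
    des n σ = ∑ k ∈ Icc 1 n, (decide (k < pval n σ (pval n σ⁻¹ k - 1))).toNat := by
  have H := inversePair_pval n σ
  rw [← H.sum_comp fun i k => (decide (k < pval n σ (i - 1))).toNat, des]
  have : ∀ i, (decide (pval n σ i < pval n σ (i - 1))).toNat =
      if pval n σ i < pval n σ (i - 1) then 1 else 0 := by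
    intro i
    by_cases h : pval n σ i < pval n σ (i - 1) <;> simp [h]
  simp only [this]
  rw [← card_filter]
  refine card_bij (fun i _ => i + 1) ?_ (fun a _ b _ h => by omega) ?_
  · intro i hi
    simp only [mem_filter, mem_Icc, Nat.add_sub_cancel] at hi ⊢
    omega
  · intro i hi
    simp only [mem_filter, mem_Icc] at hi ⊢
    have h0 : i = 1 → pval n σ (i - 1) = 0 := fun h => by
      rw [h]
      exact H.left_zero
    refine ⟨i - 1, ?_, by omega⟩
    rw [Nat.sub_add_cancel (by omega)]
    omega

theorem sum_res_les_des {R : Type*} [CommSemiring R] (p q t : R) (n : ℕ) :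
    ∑ σ : Equiv.Perm (Fin (n + 1)),
      p ^ res (n + 1) σ * q ^ les (n + 1) σ * t ^ des (n + 1) σ =
      motzkinTotal p q t (n + 1) 1 := by
  rw [motzkinTotal, ← sum_prod_eq_pathTotal (motzkinWeight p q t)
    (fun σ k => motzkinLabel (n + 1) (pval (n + 1) σ) (pval (n + 1) σ⁻¹) (k + 1))
    (fun σ k => crossingDescents (n + 1) (pval (n + 1) σ) (k + 1))]
  · refine sum_congr rfl fun σ _ => ?_
    have H := inversePair_pval (n + 1) σ
    rw [res_eq_sum, les_eq_sum, des_eq_sum, ← prod_pow_mul_pow_mul_pow,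
      prod_range_add_one fun k => motzkinWeight p q t
        (crossingDescents (n + 1) (pval (n + 1) σ) k)
        (motzkinLabel (n + 1) (pval (n + 1) σ) (pval (n + 1) σ⁻¹) k)]
    refine prod_congr rfl fun k hk => ?_
    rw [mem_Icc] at hk
    rw [H.crossingDescents_eq hk.1 hk.2, motzkinWeight, motzkinLabel]
    congr 3
    simp only
    omega
  · intro σ
    have H := inversePair_pval (n + 1) σ
    rw [crossingDescents, card_eq_one]
    refine ⟨n + 1, ?_⟩
    ext j
    rw [mem_filter, mem_range, mem_singleton]
    refine ⟨fun h => ?_, fun h => ?_⟩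
    · by_contra hj
      have := H.left (j + 1) (by omega) (by omega)
      omega
    · have h1 := H.left (n + 1) (by omega) le_rfl
      have h2 := H.left_out (n + 1 + 1) (by omega)
      rw [h]
      omega
  · intro σ
    have H := inversePair_pval (n + 1) σ
    rw [crossingDescents, card_eq_zero, filter_eq_empty_iff]
    intro j hj
    rw [mem_range] at hj
    rcases Nat.eq_zero_or_pos j with rfl | hj0
    · rw [H.left_zero]
      omega
    · have := H.left j hj0 (by omega)
      omega
  · intro σ k hk
    have H := inversePair_pval (n + 1) σ
    rw [H.crossingDescents_eq (by omega) (by omega), motzkinSteps, motzkinLabel, mem_product,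
      mem_range]
    exact ⟨by simp only; omega, mem_univ _⟩
  · intro σ k hk
    exact (inversePair_pval (n + 1) σ).crossingDescents_succ (by omega) (by omega)
  · intro σ τ h
    refine inv_injective (pval_injective _ ?_)
    refine (inversePair_pval (n + 1) σ).eq_of_motzkinLabel_eq (inversePair_pval (n + 1) τ) ?_
    intro k h1 h2
    have := h (k - 1) (by omega)
    rwa [Nat.sub_add_cancel h1] at this
  · rw [motzkin_count, Fintype.card_perm, Fintype.card_fin]

/-! ### The code of a permutation recording `nest` and `cros` -/

/-- The number of arcs `v ← r v` nesting the arc `s x ← x`. -/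
def nestAt (n : ℕ) (s r : ℕ → ℕ) (x : ℕ) : ℕ :=
  #{v ∈ Icc 1 n | v < s x ∧ x < r v}

/-- The number of arcs `v ← r v` with `v < b` and `x < r v` crossing the arc `s x ← x`. -/
def crosAt (n : ℕ) (s r : ℕ → ℕ) (x b : ℕ) : ℕ :=
  #{v ∈ Icc 1 n | s x < v ∧ v < b ∧ x < r v}

/-- The number of arcs `y → s y` leaving `{1, …, x - 1}`. -/
def leavingArcs (n : ℕ) (s : ℕ → ℕ) (x : ℕ) : ℕ :=
  #{y ∈ Icc 1 n | y < x ∧ x ≤ s y}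

/-- The number of arcs `y → s y` passing strictly over `x`. -/
def overArcs (n : ℕ) (s : ℕ → ℕ) (x : ℕ) : ℕ :=
  #{y ∈ Icc 1 n | y < x ∧ x < s y}

/-- The Dyck labels: the position `x` and the value `x` are treated at the times `2 (x - 1)` and
`2 (x - 1) + 1`, respectively. -/
def dyckLabel (n : ℕ) (s r : ℕ → ℕ) (m : ℕ) : Option ℕ :=
  if m % 2 = 0 then
    if s (m / 2 + 1) < m / 2 + 1 then some (nestAt n s r (m / 2 + 1)) else none
  else
    if r (m / 2 + 1) ≤ m / 2 + 1 then some (nestAt n r s (m / 2 + 1)) else none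

/-- The heights of the Dyck path of a permutation. -/
def dyckHeight (n : ℕ) (s r : ℕ → ℕ) (m : ℕ) : ℕ :=
  if m % 2 = 0 then 2 * leavingArcs n s (m / 2 + 1) else 2 * overArcs n r (m / 2 + 1) + 1

section

variable (n : ℕ) (s r : ℕ → ℕ) (i : ℕ)

theorem dyckLabel_even : dyckLabel n s r (2 * i) =
    if s (i + 1) < i + 1 then some (nestAt n s r (i + 1)) else none := by
  simp [dyckLabel]

theorem dyckLabel_odd : dyckLabel n s r (2 * i + 1) =
    if r (i + 1) ≤ i + 1 then some (nestAt n r s (i + 1)) else none := by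
  rw [dyckLabel, if_neg (by omega), show (2 * i + 1) / 2 = i by omega]

theorem dyckHeight_even : dyckHeight n s r (2 * i) = 2 * leavingArcs n s (i + 1) := by
  simp [dyckHeight]

theorem dyckHeight_odd : dyckHeight n s r (2 * i + 1) = 2 * overArcs n r (i + 1) + 1 := by
  rw [dyckHeight, if_neg (by omega), show (2 * i + 1) / 2 = i by omega]

end

theorem prod_range_two_mul {M : Type*} [CommMonoid M] (f : ℕ → M) (n : ℕ) :
    ∏ k ∈ range (2 * n), f k = ∏ k ∈ range n, f (2 * k) * f (2 * k + 1) := by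
  induction n with
  | zero => simp
  | succ n ih =>
    rw [show 2 * (n + 1) = 2 * n + 1 + 1 by ring, prod_range_succ, prod_range_succ,
      prod_range_succ, ih, mul_assoc]

namespace InversePair

variable {n : ℕ} {s r s' r' : ℕ → ℕ}

theorem eq_iff (H : InversePair n s r) {y v : ℕ} (hy : 1 ≤ y) (hy' : y ≤ n) (hv : 1 ≤ v)
    (hv' : v ≤ n) : s y = v ↔ r v = y := by
  have h1 := H.left y hy hy'
  have h2 := H.right v hv hv'
  constructor <;> rintro rfl
  · exact h1.2.2
  · exact h2.2.2

theorem leavingArcs_eq (H : InversePair n s r) {x : ℕ} (h1 : 1 ≤ x) (h2 : x ≤ n) :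
    leavingArcs n s x = overArcs n s x + if r x < x then 1 else 0 := by
  have hr := H.right x h1 h2
  have e : (if r x < x then 1 else 0) =
      ∑ y ∈ Icc 1 n, if y = r x ∧ r x < x then 1 else 0 := by
    rw [sum_eq_single (r x)]
    · simp
    · intro y _ hy
      simp [hy]
    · intro h
      rw [mem_Icc] at h
      omega
  rw [e, leavingArcs, overArcs, card_filter, card_filter, ← sum_add_distrib]
  refine sum_congr rfl fun y hy => ?_
  rw [mem_Icc] at hy
  have := H.eq_iff hy.1 hy.2 h1 h2
  split_ifs <;> omega

theorem leavingArcs_succ {x : ℕ} (h1 : 1 ≤ x) (h2 : x ≤ n) :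
    leavingArcs n s (x + 1) = overArcs n s x + if x < s x then 1 else 0 := by
  have e : (if x < s x then 1 else 0) = ∑ y ∈ Icc 1 n, if y = x ∧ x < s x then 1 else 0 := by
    rw [sum_eq_single x]
    · simp
    · intro y _ hy
      simp [hy]
    · intro h
      rw [mem_Icc] at h
      omega
  rw [e, leavingArcs, overArcs, card_filter, card_filter, ← sum_add_distrib]
  refine sum_congr rfl fun y _ => ?_
  rcases eq_or_ne y x with rfl | hne
  · split_ifs <;> omega
  · split_ifs <;> omega

theorem leavingArcs_one : leavingArcs n s 1 = 0 := by
  rw [leavingArcs, card_eq_zero, filter_eq_empty_iff]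
  intro y hy
  rw [mem_Icc] at hy
  omega

theorem leavingArcs_end (H : InversePair n s r) : leavingArcs n s (n + 1) = 0 := by
  rw [leavingArcs, card_eq_zero, filter_eq_empty_iff]
  intro y hy
  rw [mem_Icc] at hy
  have := H.left y hy.1 hy.2
  omega

theorem leavingArcs_symm (H : InversePair n s r) {x : ℕ} (h1 : 1 ≤ x) (h2 : x ≤ n + 1) :
    leavingArcs n s x = leavingArcs n r x := by
  induction x, h1 using Nat.le_induction with
  | base => rw [leavingArcs_one, leavingArcs_one]
  | succ x h1 ih =>
    have ih := ih (by omega)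
    rw [H.leavingArcs_eq h1 (by omega), H.symm.leavingArcs_eq h1 (by omega)] at ih
    rw [leavingArcs_succ h1 (by omega), leavingArcs_succ h1 (by omega)]
    have := H.eq_iff h1 (by omega : x ≤ n) h1 (by omega)
    split_ifs at * <;> omega

theorem overArcs_of_lt (H : InversePair n s r) {x : ℕ} (h1 : 1 ≤ x) (h2 : x ≤ n)
    (hx : s x < x) : overArcs n r x = nestAt n s r x + crosAt n s r x x := by
  rw [nestAt, crosAt, overArcs, card_filter, card_filter, card_filter, ← sum_add_distrib]
  refine sum_congr rfl fun v hv => ?_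
  rw [mem_Icc] at hv
  have := H.eq_iff h1 h2 hv.1 hv.2
  split_ifs <;> omega

theorem overArcs_of_le (H : InversePair n s r) {x : ℕ} (h1 : 1 ≤ x) (h2 : x ≤ n)
    (hx : r x ≤ x) : overArcs n r x = nestAt n r s x + crosAt n r s x (x + 1) := by
  have h : leavingArcs n r (x + 1) = overArcs n r x := by
    rw [leavingArcs_succ h1 h2, if_neg (by omega), add_zero]
  rw [← h, ← H.leavingArcs_symm (by omega) (by omega), nestAt, crosAt, leavingArcs, card_filter,
    card_filter, card_filter, ← sum_add_distrib]
  refine sum_congr rfl fun v hv => ?_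
  rw [mem_Icc] at hv
  have := H.symm.eq_iff h1 h2 hv.1 hv.2
  split_ifs <;> omega

theorem dyckLabel_mem (H : InversePair n s r) {m : ℕ} (hm : m < 2 * n) :
    dyckLabel n s r m ∈ dyckSteps (dyckHeight n s r m) := by
  obtain ⟨i, rfl | rfl⟩ := m.even_or_odd'
  · rw [dyckLabel_even, dyckHeight_even, dyckSteps]
    split_ifs with h
    · rw [H.leavingArcs_symm (by omega) (by omega), H.symm.leavingArcs_eq (by omega) (by omega),
        if_pos h, H.overArcs_of_lt (by omega) (by omega) h, some_mem_insertNone, mem_range]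
      omega
    · exact none_mem_insertNone
  · rw [dyckLabel_odd, dyckHeight_odd, dyckSteps]
    split_ifs with h
    · rw [H.overArcs_of_le (by omega) (by omega) h, some_mem_insertNone, mem_range]
      omega
    · exact none_mem_insertNone

theorem dyckHeight_succ (H : InversePair n s r) {m : ℕ} (hm : m < 2 * n) :
    dyckHeight n s r (m + 1) = dyckNext (dyckHeight n s r m) (dyckLabel n s r m) := by
  obtain ⟨i, rfl | rfl⟩ := m.even_or_odd'
  · rw [dyckLabel_even, dyckHeight_even, dyckHeight_odd, H.leavingArcs_symm (by omega) (by omega),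
      H.symm.leavingArcs_eq (by omega) (by omega)]
    split_ifs with h <;> simp only [dyckNext] <;> omega
  · rw [dyckLabel_odd, show 2 * i + 1 + 1 = 2 * (i + 1) by ring, dyckHeight_odd, dyckHeight_even,
      H.leavingArcs_symm (by omega) (by omega), leavingArcs_succ (by omega) (by omega)]
    split_ifs <;> simp only [dyckNext] <;> omega

theorem nestAt_lt_nestAt (H : InversePair n s r) (H' : InversePair n s' r') {x : ℕ} (h1 : 1 ≤ x)
    (h2 : x ≤ n) (h : ∀ v, 1 ≤ v → v < x → (r v < x ↔ r' v < x)) (hx : s' x ≤ x)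
    (hlt : s x < s' x) : nestAt n s r x < nestAt n s' r' x := by
  have hs := H.left x h1 h2
  refine card_lt_card ((ssubset_iff_of_subset ?_).2 ⟨s x, ?_, ?_⟩)
  · intro v hv
    simp only [mem_filter, mem_Icc] at hv ⊢
    have := H'.eq_iff h1 h2 hv.1.1 hv.1.2
    have := h v hv.1.1 (by omega)
    omega
  · simp only [mem_filter, mem_Icc]
    have := H'.eq_iff h1 h2 hs.1 hs.2.1
    have := h (s x) hs.1 (by omega)
    omega
  · simp

theorem eq_of_nestAt_eq (H : InversePair n s r) (H' : InversePair n s' r') {x : ℕ} (h1 : 1 ≤ x)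
    (h2 : x ≤ n) (h : ∀ v, 1 ≤ v → v < x → (r v < x ↔ r' v < x)) (hx : s x ≤ x) (hx' : s' x ≤ x)
    (heq : nestAt n s r x = nestAt n s' r' x) : s x = s' x := by
  rcases lt_trichotomy (s x) (s' x) with hlt | heq | hlt
  · exact absurd heq (H.nestAt_lt_nestAt H' h1 h2 h hx' hlt).ne
  · exact heq
  · exact absurd heq (H'.nestAt_lt_nestAt H h1 h2 (fun v hv hv' => (h v hv hv').symm) hx hlt).ne'

theorem eq_iff_eq_of_dyckLabel_eq (H : InversePair n s r) (H' : InversePair n s' r')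
    (h : ∀ m < 2 * n, dyckLabel n s r m = dyckLabel n s' r' m) (k : ℕ) (hk : k ≤ n + 1) :
    ∀ y v, 1 ≤ y → 1 ≤ v → y < k → v < k → (s y = v ↔ s' y = v) := by
  induction k with
  | zero => intro y v _ _ hy; omega
  | succ k ih =>
    have ih := ih (by omega)
    intro y v hy hv hyk hvk
    have hr : ∀ v, 1 ≤ v → v < k → (r v < k ↔ r' v < k) := by
      intro v h1 h2
      have ha := H.right v h1 (by omega)
      have ha' := H'.right v h1 (by omega)
      constructor <;> intro hlt
      · rw [← (H'.eq_iff ha.1 ha.2.1 h1 (by omega)).1 ((ih _ _ ha.1 h1 hlt h2).1 ha.2.2)] at hlt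
        exact hlt
      · rw [← (H.eq_iff ha'.1 ha'.2.1 h1 (by omega)).1 ((ih _ _ ha'.1 h1 hlt h2).2 ha'.2.2)] at hlt
        exact hlt
    have hs : ∀ v, 1 ≤ v → v < k → (s v < k ↔ s' v < k) := by
      intro v h1 h2
      have ha := H.left v h1 (by omega)
      have ha' := H'.left v h1 (by omega)
      constructor <;> intro hlt
      · rw [(ih v _ h1 ha.1 h2 hlt).1 rfl]
        exact hlt
      · rw [(ih v _ h1 ha'.1 h2 hlt).2 rfl]
        exact hlt
    have hpos : (s k < k ∧ s' k < k ∧ s k = s' k) ∨ (k ≤ s k ∧ k ≤ s' k) := by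
      have hl := h (2 * (k - 1)) (by omega)
      rw [dyckLabel_even, dyckLabel_even, Nat.sub_add_cancel (by omega)] at hl
      split_ifs at hl with h1 h2
      · exact Or.inl ⟨h1, h2, H.eq_of_nestAt_eq H' (by omega) (by omega) hr h1.le h2.le
          (Option.some_inj.1 hl)⟩
      · omega
    have hval : (r k ≤ k ∧ r' k ≤ k ∧ r k = r' k) ∨ (k < r k ∧ k < r' k) := by
      have hl := h (2 * (k - 1) + 1) (by omega)
      rw [dyckLabel_odd, dyckLabel_odd, Nat.sub_add_cancel (by omega)] at hl
      split_ifs at hl with h1 h2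
      · exact Or.inl ⟨h1, h2, H.symm.eq_of_nestAt_eq H'.symm (by omega) (by omega) hs h1 h2
          (Option.some_inj.1 hl)⟩
      · omega
    rcases Nat.lt_succ_iff_lt_or_eq.1 hvk with hvk | rfl
    · rcases Nat.lt_succ_iff_lt_or_eq.1 hyk with hyk | rfl
      · exact ih y v hy hv hyk hvk
      · omega
    · rw [H.eq_iff hy (by omega) hv (by omega), H'.eq_iff hy (by omega) hv (by omega)]
      omega

theorem eq_of_dyckLabel_eq (H : InversePair n s r) (H' : InversePair n s' r')
    (h : ∀ m < 2 * n, dyckLabel n s r m = dyckLabel n s' r' m) :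
    ∀ y, 1 ≤ y → y ≤ n → s y = s' y := by
  intro y h1 h2
  have hy := H.left y h1 h2
  exact ((H.eq_iff_eq_of_dyckLabel_eq H' h (n + 1) le_rfl y (s y) h1 hy.1 (by omega)
    (by omega)).1 rfl).symm

theorem dyckWeight_even {R : Type*} [CommSemiring R] (p q t : R) (H : InversePair n s r) {i : ℕ}
    (hi : i < n) :
    dyckWeight p q t (dyckHeight n s r (2 * i)) (dyckLabel n s r (2 * i)) =
      p ^ (if s (i + 1) < i + 1 then nestAt n s r (i + 1) else 0) *
      q ^ (if s (i + 1) < i + 1 then crosAt n s r (i + 1) (i + 1) else 0) *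
      t ^ (if s (i + 1) < i + 1 then 1 else 0) := by
  rw [dyckLabel_even, dyckHeight_even]
  split_ifs with h
  · rw [H.leavingArcs_symm (by omega) (by omega), H.symm.leavingArcs_eq (by omega) (by omega),
      if_pos h, H.overArcs_of_lt (by omega) (by omega) h, dyckWeight, if_pos (by omega), pow_one,
      mul_comm]
    congr 3
    omega
  · simp [dyckWeight]

theorem dyckWeight_odd {R : Type*} [CommSemiring R] (p q t : R) (H : InversePair n s r) {i : ℕ}
    (hi : i < n) :
    dyckWeight p q t (dyckHeight n s r (2 * i + 1)) (dyckLabel n s r (2 * i + 1)) =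
      p ^ (if r (i + 1) ≤ i + 1 then nestAt n r s (i + 1) else 0) *
      q ^ (if r (i + 1) ≤ i + 1 then crosAt n r s (i + 1) (i + 1 + 1) else 0) := by
  rw [dyckLabel_odd, dyckHeight_odd]
  split_ifs with h
  · rw [H.overArcs_of_le (by omega) (by omega) h, dyckWeight, if_neg (by omega), one_mul]
    congr 2
    omega
  · simp [dyckWeight]

end InversePair

theorem drp_eq_sum (n : ℕ) (σ : Equiv.Perm (Fin n)) :
    drp n σ = ∑ x ∈ Icc 1 n, if pval n σ x < x then 1 else 0 := by
  rw [drp, card_filter]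

theorem nest_eq_sum (n : ℕ) (σ : Equiv.Perm (Fin n)) :
    nest n σ = ∑ x ∈ Icc 1 n,
      ((if pval n σ x < x then nestAt n (pval n σ) (pval n σ⁻¹) x else 0) +
        if pval n σ⁻¹ x ≤ x then nestAt n (pval n σ⁻¹) (pval n σ) x else 0) := by
  have H := inversePair_pval n σ
  rw [sum_add_distrib]
  simp only [nestAt]
  rw [← H.sum_comp fun j v => if j ≤ v then #{y ∈ Icc 1 n | y < j ∧ v < pval n σ y} else 0,
    ← sum_add_distrib, nest, card_filter_product]
  refine sum_congr rfl fun j _ => ?_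
  rcases Nat.lt_or_ge (pval n σ j) j with h | h
  · rw [if_pos h, if_neg (by omega), add_zero,
      ← H.card_comp fun i v => v < pval n σ j ∧ j < i]
    exact congrArg card (filter_congr fun i _ => by dsimp only; omega)
  · rw [if_neg (by omega), if_pos h, zero_add]
    exact congrArg card (filter_congr fun i _ => by dsimp only; omega)

theorem cros_eq_sum (n : ℕ) (σ : Equiv.Perm (Fin n)) :
    cros n σ = ∑ x ∈ Icc 1 n,
      ((if pval n σ x < x then crosAt n (pval n σ) (pval n σ⁻¹) x x else 0) +
        if pval n σ⁻¹ x ≤ x then crosAt n (pval n σ⁻¹) (pval n σ) x (x + 1) else 0) := by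
  have H := inversePair_pval n σ
  rw [sum_add_distrib]
  simp only [crosAt]
  rw [← H.sum_comp fun i v => if i ≤ v then
    #{y ∈ Icc 1 n | i < y ∧ y < v + 1 ∧ v < pval n σ y} else 0]
  have hlow : ∀ j, #{v ∈ Icc 1 n | pval n σ j < v ∧ v < j ∧ j < pval n σ⁻¹ v} =
      #{i ∈ Icc 1 n | pval n σ j < pval n σ i ∧ pval n σ i < j ∧ j < i} := fun j =>
    (H.card_comp fun i v => pval n σ j < v ∧ v < j ∧ j < i).symm
  simp only [hlow]
  rw [cros, filter_or, card_union_of_disjoint, add_comm]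
  · congr 1
    · rw [card_filter_product]
      refine sum_congr rfl fun j _ => ?_
      split_ifs with h
      · exact congrArg card (filter_congr fun i _ => by dsimp only; omega)
      · rw [card_eq_zero, filter_eq_empty_iff]
        intro i _
        dsimp only
        omega
    · rw [card_filter, sum_product]
      refine sum_congr rfl fun i _ => ?_
      rw [← card_filter]
      split_ifs with h
      · exact congrArg card (filter_congr fun j _ => by dsimp only; omega)
      · rw [card_eq_zero, filter_eq_empty_iff]
        intro j _
        dsimp only
        omega
  · rw [disjoint_filter]
    intro x _
    omega

theorem sum_nest_cros_drp {R : Type*} [CommSemiring R] (p q t : R) (n : ℕ) :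
    ∑ σ : Equiv.Perm (Fin (n + 1)),
      p ^ nest (n + 1) σ * q ^ cros (n + 1) σ * t ^ drp (n + 1) σ =
      dyckTotal p q t (2 * (n + 1)) 0 := by
  rw [dyckTotal, ← sum_prod_eq_pathTotal (dyckWeight p q t)
    (fun σ => dyckLabel (n + 1) (pval (n + 1) σ) (pval (n + 1) σ⁻¹))
    (fun σ => dyckHeight (n + 1) (pval (n + 1) σ) (pval (n + 1) σ⁻¹))]
  · refine sum_congr rfl fun σ _ => ?_
    have H := inversePair_pval (n + 1) σ
    rw [nest_eq_sum, cros_eq_sum, drp_eq_sum, ← prod_pow_mul_pow_mul_pow, ← prod_range_add_one,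
      prod_range_two_mul]
    refine prod_congr rfl fun i hi => ?_
    rw [mem_range] at hi
    rw [H.dyckWeight_even p q t hi, H.dyckWeight_odd p q t hi, pow_add, pow_add]
    ring
  · intro σ
    rw [show 0 = 2 * 0 by rfl, dyckHeight_even, zero_add, InversePair.leavingArcs_one]
  · intro σ
    rw [dyckHeight_even, (inversePair_pval (n + 1) σ).leavingArcs_end]
  · exact fun σ m hm => (inversePair_pval (n + 1) σ).dyckLabel_mem hm
  · exact fun σ m hm => (inversePair_pval (n + 1) σ).dyckHeight_succ hm
  · exact fun σ τ h => pval_injective _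
      ((inversePair_pval (n + 1) σ).eq_of_dyckLabel_eq (inversePair_pval (n + 1) τ) h)
  · rw [dyck_count, Fintype.card_perm, Fintype.card_fin]

/-- `Σ_σ p^(res σ) q^(les σ) t^(des σ) = Σ_σ p^(nest σ) q^(cros σ) t^(drop σ)`. -/
theorem statement9 (n : ℕ) (hn : 0 < n) :
    (∑ σ : Equiv.Perm (Fin n),
      (X 0 : MvPolynomial (Fin 3) ℤ) ^ (res n σ) * (X 1) ^ (les n σ) * (X 2) ^ (des n σ)) =
    ∑ σ : Equiv.Perm (Fin n),
      (X 0 : MvPolynomial (Fin 3) ℤ) ^ (nest n σ) * (X 1) ^ (cros n σ) * (X 2) ^ (drp n σ) := by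
  obtain ⟨n, rfl⟩ := Nat.exists_eq_add_one.2 hn
  rw [sum_res_les_des, sum_nest_cros_drp, dyckTotal_zero]
end

section
/- For every positive integer n, the number of descents, the number of excedances, and the number of drops are equidistributed on S_n: Σ_{σ ∈ S_n} t^{des σ} = Σ_{σ ∈ S_n} t^{exc σ} = Σ_{σ ∈ S_n} t^{drop σ}, as polynomials in t (the common value being the Eulerian polynomial A_n(t)). -/
open Finset MvPolynomial

/-- If the permutations of `Fin (n + 1)` arise from those of `Fin n` by `n + 1` insertions each,
of which the insertion `0` and those indexed by a set of size `f σ` preserve the statistic and all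
others increase it by one, then the generating functions satisfy the Eulerian recurrence. -/
theorem sum_X_pow_eq_of_insertion {n : ℕ} {f : Equiv.Perm (Fin n) → ℕ}
    {g : Equiv.Perm (Fin (n + 1)) → ℕ}
    {Φ : Fin (n + 1) × Equiv.Perm (Fin n) → Equiv.Perm (Fin (n + 1))}
    (hΦ : Function.Bijective Φ) (D : Equiv.Perm (Fin n) → Finset (Fin n))
    (hD : ∀ σ, (D σ).card = f σ) (h0 : ∀ σ, g (Φ (0, σ)) = f σ)
    (hs : ∀ σ j, g (Φ (j.succ, σ)) = if j ∈ D σ then f σ else f σ + 1) :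
    ∑ σ, (Polynomial.X : Polynomial ℤ) ^ g σ =
      (1 + (n : Polynomial ℤ) * Polynomial.X) * (∑ σ, (Polynomial.X : Polynomial ℤ) ^ f σ) +
        Polynomial.X * (1 - Polynomial.X) *
          Polynomial.derivative (∑ σ, (Polynomial.X : Polynomial ℤ) ^ f σ) := by
  rw [← hΦ.sum_comp, Fintype.sum_prod_type_right, Polynomial.derivative_sum, mul_sum, mul_sum,
    ← sum_add_distrib]
  refine sum_congr rfl fun σ _ => ?_
  have hX : (Polynomial.X : Polynomial ℤ) * Polynomial.derivative (Polynomial.X ^ f σ) =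
      (f σ : Polynomial ℤ) * Polynomial.X ^ f σ := by
    rcases f σ with _ | k
    · simp
    · rw [Polynomial.derivative_X_pow, Nat.add_sub_cancel, Polynomial.C_eq_natCast]
      ring
  have hsum : ∀ j, (Polynomial.X : Polynomial ℤ) ^ g (Φ (j.succ, σ)) =
      Polynomial.X ^ (f σ + 1) +
        if j ∈ D σ then Polynomial.X ^ f σ * (1 - Polynomial.X) else 0 := by
    intro j
    rw [hs]
    split_ifs <;> ring
  rw [Fin.sum_univ_succ, h0, sum_congr rfl fun j _ => hsum j, sum_add_distrib, sum_ite_mem,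
    univ_inter, sum_const, sum_const, hD, card_univ, Fintype.card_fin, nsmul_eq_mul, nsmul_eq_mul]
  linear_combination (-(1 - Polynomial.X)) * hX

/-- The value of `pval` at the 1-based index of a position. -/
theorem pval_succ {n : ℕ} (σ : Equiv.Perm (Fin n)) (i : Fin n) :
    pval n σ (i + 1) = σ i + 1 := by
  simp [pval]

/-- Counting 1-based indices in `[n]` amounts to counting elements of `Fin n`. -/
theorem card_filter_Icc_one_eq {n : ℕ} (P : ℕ → Prop) [DecidablePred P] (Q : Fin n → Prop)
    [DecidablePred Q] (h : ∀ i : Fin n, P (i + 1) ↔ Q i) :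
    ((Finset.Icc 1 n).filter P).card = (univ.filter Q).card := by
  symm
  refine card_bij (fun i _ => (i : ℕ) + 1) ?_ ?_ ?_
  · intro i hi
    have := i.isLt
    simp_all
  · intro i _ j _ hij
    exact Fin.ext (Nat.succ.inj hij)
  · intro b hb
    rw [mem_filter, mem_Icc] at hb
    obtain ⟨⟨hb1, hbn⟩, hP⟩ := hb
    obtain ⟨c, rfl⟩ := Nat.exists_eq_add_of_le' hb1
    exact ⟨⟨c, hbn⟩, by simpa [← h] using hP, rfl⟩

theorem exc_eq_card {n : ℕ} (σ : Equiv.Perm (Fin n)) :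
    exc n σ = (univ.filter fun i => i < σ i).card :=
  card_filter_Icc_one_eq _ _ fun i => by simp [pval_succ]

theorem drp_eq_card {n : ℕ} (σ : Equiv.Perm (Fin n)) :
    drp n σ = (univ.filter fun i => σ i < i).card :=
  card_filter_Icc_one_eq _ _ fun i => by simp [pval_succ]

/-- The positions of `σ` at which a descent starts. -/
def descentSet {n : ℕ} (σ : Equiv.Perm (Fin n)) : Finset (Fin n) :=
  univ.filter fun i => ∃ k : Fin n, (k : ℕ) = i + 1 ∧ σ k < σ i

theorem mem_descentSet {n : ℕ} {σ : Equiv.Perm (Fin n)} {i : Fin n} :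
    i ∈ descentSet σ ↔ ∃ k : Fin n, (k : ℕ) = i + 1 ∧ σ k < σ i := by
  simp [descentSet]

theorem des_eq_card {n : ℕ} (σ : Equiv.Perm (Fin n)) : des n σ = (descentSet σ).card := by
  rw [descentSet, ← card_filter_Icc_one_eq
    (fun i => i ≤ n - 1 ∧ pval n σ (i + 1) < pval n σ i), des]
  · congr 1
    ext i
    simp only [mem_filter, mem_Icc]
    grind
  · intro i
    constructor
    · rintro ⟨hi, hlt⟩
      have hk : (i : ℕ) + 1 < n := by omega
      have := pval_succ σ ⟨i + 1, hk⟩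
      refine ⟨⟨i + 1, hk⟩, rfl, ?_⟩
      rw [Fin.lt_def]
      simp only [pval_succ] at this hlt
      omega
    · rintro ⟨k, hk, hlt⟩
      have hkn := k.isLt
      rw [← hk, pval_succ, hk, pval_succ]
      rw [Fin.lt_def] at hlt
      omega

theorem exc_eq_drp_inv {n : ℕ} (σ : Equiv.Perm (Fin n)) : exc n σ = drp n σ⁻¹ := by
  rw [exc_eq_card, drp_eq_card]
  exact card_equiv σ fun i => by simp

theorem exc_decomposeFin_symm_zero {n : ℕ} (σ : Equiv.Perm (Fin n)) :
    exc (n + 1) (Equiv.Perm.decomposeFin.symm (0, σ)) = exc n σ := by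
  rw [exc_eq_card, exc_eq_card, ← card_map (Fin.succEmb n)]
  congr 1
  ext x
  cases x using Fin.cases <;> simp [Fin.succ_ne_zero]

theorem exc_decomposeFin_symm_succ {n : ℕ} (σ : Equiv.Perm (Fin n)) (j : Fin n) :
    exc (n + 1) (Equiv.Perm.decomposeFin.symm (j.succ, σ)) =
      if σ⁻¹ j < j then exc n σ else exc n σ + 1 := by
  have h : (univ.filter fun x => x < Equiv.Perm.decomposeFin.symm (j.succ, σ) x) =
      insert 0 (((univ.filter fun i => i < σ i).erase (σ⁻¹ j)).map (Fin.succEmb n)) := by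
    ext x
    cases x using Fin.cases with
    | zero => simp
    | succ i =>
      by_cases hi : σ i = j
      · subst hi
        simp [Fin.succ_ne_zero]
      · have hi' : i ≠ σ.symm j := by
          rintro rfl
          simp at hi
        rw [mem_filter, Equiv.Perm.decomposeFin_symm_apply_succ,
          Equiv.swap_apply_of_ne_of_ne (Fin.succ_ne_zero _) (by simpa using hi)]
        simp [Fin.succ_ne_zero, hi']
  rw [exc_eq_card, exc_eq_card, h, card_insert_of_notMem (by simp [Fin.succ_ne_zero]), card_map]
  split_ifs with hj
  · exact card_erase_add_one (by simpa using hj)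
  · rw [erase_eq_of_notMem (by simpa using hj)]

/-- Insert a new minimal value at position `p`. -/
def insertMin {n : ℕ} (x : Fin (n + 1) × Equiv.Perm (Fin n)) : Equiv.Perm (Fin (n + 1)) :=
  Equiv.Perm.decomposeFin.symm (0, x.2) * x.1.cycleRange

theorem insertMin_self {n : ℕ} (p : Fin (n + 1)) (σ : Equiv.Perm (Fin n)) :
    insertMin (p, σ) p = 0 := by
  simp [insertMin]

theorem insertMin_succAbove {n : ℕ} (p : Fin (n + 1)) (σ : Equiv.Perm (Fin n)) (i : Fin n) :
    insertMin (p, σ) (p.succAbove i) = (σ i).succ := by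
  simp [insertMin]

theorem insertMin_bijective {n : ℕ} :
    Function.Bijective (insertMin : Fin (n + 1) × Equiv.Perm (Fin n) → _) := by
  rw [Fintype.bijective_iff_injective_and_card]
  refine ⟨?_, (Fintype.card_congr Equiv.Perm.decomposeFin).symm⟩
  rintro ⟨p, σ⟩ ⟨q, τ⟩ h
  have hpq : p = q := (insertMin (q, τ)).injective <| by
    rw [insertMin_self, ← h, insertMin_self]
  subst hpq
  simpa [insertMin] using h

theorem descentSet_insertMin_zero {n : ℕ} (σ : Equiv.Perm (Fin n)) :
    descentSet (insertMin (0, σ)) = (descentSet σ).map (Fin.succEmb n) := by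
  have hs (i : Fin n) : insertMin (0, σ) i.succ = (σ i).succ := insertMin_succAbove 0 σ i
  ext x
  cases x using Fin.cases with
  | zero => simp [mem_descentSet, insertMin_self, Fin.succ_ne_zero]
  | succ i => simp [mem_descentSet, Fin.exists_fin_succ, hs]

theorem descentSet_insertMin_succ {n : ℕ} (σ : Equiv.Perm (Fin n)) (j : Fin n) :
    descentSet (insertMin (j.succ, σ)) =
      (insert j (descentSet σ)).map j.succ.succAboveEmb := by
  ext x
  cases x using Fin.succAboveCases j.succ with
  | x => simp [mem_descentSet, insertMin_self, Fin.castSucc_lt_succ.ne']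
  | p i =>
    have hv (i : Fin n) : ((j.succ.succAbove i : Fin (n + 1)) : ℕ) =
        if (i : ℕ) ≤ j then (i : ℕ) else i + 1 := by
      simp only [Fin.succAbove, Fin.lt_def, Fin.val_castSucc, Fin.val_succ, Nat.lt_succ_iff]
      split_ifs <;> rfl
    have hm (s : Finset (Fin n)) : j.succ.succAbove i ∈ s.map j.succ.succAboveEmb ↔ i ∈ s :=
      mem_map' _
    rw [hm, mem_insert, mem_descentSet, mem_descentSet,
      Fin.exists_iff_succAbove j.succ]
    simp only [insertMin_self, insertMin_succAbove, hv, Fin.val_succ, Fin.succ_lt_succ_iff,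
      Fin.succ_pos, and_true]
    constructor
    · rintro (h | ⟨k, hk, hlt⟩)
      · left
        grind
      · right
        exact ⟨k, by grind, hlt⟩
    · rintro (rfl | ⟨k, hk, hlt⟩)
      · simp
      · by_cases hij : i = j
        · simp [hij]
        · right
          exact ⟨k, by grind, hlt⟩

/-- The descent generating function satisfies the Eulerian recurrence. -/
theorem sum_X_pow_des_succ (n : ℕ) :
    ∑ σ, (Polynomial.X : Polynomial ℤ) ^ des (n + 1) σ =
      (1 + (n : Polynomial ℤ) * Polynomial.X) * (∑ σ, (Polynomial.X : Polynomial ℤ) ^ des n σ) +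
        Polynomial.X * (1 - Polynomial.X) *
          Polynomial.derivative (∑ σ, (Polynomial.X : Polynomial ℤ) ^ des n σ) := by
  refine sum_X_pow_eq_of_insertion insertMin_bijective descentSet (fun σ => (des_eq_card σ).symm)
    (fun σ => ?_) fun σ j => ?_
  · rw [des_eq_card, des_eq_card, descentSet_insertMin_zero, card_map]
  · rw [des_eq_card, des_eq_card, descentSet_insertMin_succ, card_map, card_insert_eq_ite]

/-- The excedance generating function satisfies the Eulerian recurrence. -/
theorem sum_X_pow_exc_succ (n : ℕ) :
    ∑ σ, (Polynomial.X : Polynomial ℤ) ^ exc (n + 1) σ =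
      (1 + (n : Polynomial ℤ) * Polynomial.X) * (∑ σ, (Polynomial.X : Polynomial ℤ) ^ exc n σ) +
        Polynomial.X * (1 - Polynomial.X) *
          Polynomial.derivative (∑ σ, (Polynomial.X : Polynomial ℤ) ^ exc n σ) := by
  refine sum_X_pow_eq_of_insertion Equiv.Perm.decomposeFin.symm.bijective
    (fun σ => univ.filter fun j => σ⁻¹ j < j) (fun σ => ?_) exc_decomposeFin_symm_zero
    fun σ j => ?_
  · rw [exc_eq_drp_inv, drp_eq_card]
  · simp [exc_decomposeFin_symm_succ]

theorem sum_X_pow_des_eq_sum_X_pow_exc (n : ℕ) :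
    ∑ σ, (Polynomial.X : Polynomial ℤ) ^ des n σ =
      ∑ σ, (Polynomial.X : Polynomial ℤ) ^ exc n σ := by
  induction n with
  | zero => simp [des, exc]
  | succ n ih => rw [sum_X_pow_des_succ, sum_X_pow_exc_succ, ih]

/-- Descents, excedances and drops are equidistributed on `S_n`. -/
theorem statement11 (n : ℕ) (hn : 0 < n) :
    (∑ σ : Equiv.Perm (Fin n), (Polynomial.X : Polynomial ℤ) ^ (des n σ)) =
      (∑ σ : Equiv.Perm (Fin n), (Polynomial.X : Polynomial ℤ) ^ (exc n σ)) ∧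
    (∑ σ : Equiv.Perm (Fin n), (Polynomial.X : Polynomial ℤ) ^ (exc n σ)) =
      ∑ σ : Equiv.Perm (Fin n), (Polynomial.X : Polynomial ℤ) ^ (drp n σ) := by
  refine ⟨sum_X_pow_des_eq_sum_X_pow_exc n, ?_⟩
  simp only [exc_eq_drp_inv]
  exact Equiv.sum_comp (Equiv.inv _) fun σ => (Polynomial.X : Polynomial ℤ) ^ drp n σ
end
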